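/- Let r ≥ 0, β = (a,b) ample, and f ∈ S_β nondegenerate. Then J₁(f) ∩ S_{β+K} = {0}, i.e., the quotient map S_{β+K} → R₁(f)_{β+K} is an isomorphism; in particular dim_ℂ R₁(f)_{β+K} = dim_ℂ S_{β+K} = g, the genus of the curve {f = 0} ⊂ ℋ_r. -/

import Mathlib

open MvPolynomial

noncomputable section

/-- The Cox ring of the Hirzebruch surface: `ℂ[x₁,x₂,x₃,x₄]`. -/
abbrev S : Type := MvPolynomial (Fin 4) ℂ

/-- The ℤ²-degree of a monomial exponent vector for the Hirzebruch grading: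
`deg x₁ = deg x₃ = (1,0)`, `deg x₂ = (0,1)`, `deg x₄ = (r,1)`. -/
def wdeg (r : ℕ) (c : Fin 4 →₀ ℕ) : ℤ × ℤ :=
  ((c 0 : ℤ) + (c 2 : ℤ) + (r : ℤ) * (c 3 : ℤ), (c 1 : ℤ) + (c 3 : ℤ))

/-- The graded piece `S_γ`: the span of monomials of degree `γ`. -/
def Sgr (r : ℕ) (γ : ℤ × ℤ) : Submodule ℂ S where
  carrier := {f : S | ∀ c ∈ f.support, wdeg r c = γ}
  add_mem' := by
    intro f g hf hg c hc
    rcases Finset.mem_union.mp (MvPolynomial.support_add hc) with h | h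
    · exact hf c h
    · exact hg c h
  zero_mem' := by
    intro c hc
    simp at hc
  smul_mem' := by
    intro t f hf c hc
    exact hf c (MvPolynomial.support_smul hc)

/-- The ideal `J₀(f)`, generated by `xᵢ ∂f/∂xᵢ`, `i = 1,…,4`. -/
def J0 (f : S) : Ideal S :=
  Ideal.span {g : S | ∃ i : Fin 4, g = X i * pderiv i f}

/-- The ideal quotient `J₁(f) = J₀(f) : (x₁x₂x₃x₄)`. -/
def J1 (f : S) : Ideal S :=
  Submodule.colon (J0 f) (Ideal.span {(X 0 * X 1 * X 2 * X 3 : S)})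

/-- The exceptional set `Z(Σ)` of the quotient construction of the Hirzebruch surface. -/
def Zexc : Set (Fin 4 → ℂ) :=
  {p | p 2 * p 3 = 0 ∧ p 0 * p 3 = 0 ∧ p 0 * p 1 = 0 ∧ p 1 * p 2 = 0}

/-- `f` is nondegenerate: `x₁∂f/∂x₁, …, x₄∂f/∂x₄` have no common zero outside `Z(Σ)`. -/
def Nondeg (f : S) : Prop :=
  ∀ p : Fin 4 → ℂ, p ∉ Zexc → ∃ i : Fin 4, eval p (X i * pderiv i f) ≠ 0

/-- The graded piece `R₁(f)_γ = S_γ/(J₁(f) ∩ S_γ)`, realized as the image of `S_γ`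
in the quotient ring `S ⧸ J₁(f)`. -/
def R1 (r : ℕ) (f : S) (γ : ℤ × ℤ) : Submodule ℂ (S ⧸ J1 f) :=
  (Sgr r γ).map (Ideal.Quotient.mkₐ ℂ (J1 f)).toLinearMap

/-- Nondegeneracy (on both sides) of the multiplication pairing
`R₁(f)_γ × R₁(f)_γ' → R₁(f)_{γ+γ'}`, stated elementwise: a class `[x]` is nonzero
iff `x ∉ J₁(f)`, and the pairing of `[x]` and `[y]` is nonzero iff `x*y ∉ J₁(f)`. -/
def NondegPair (r : ℕ) (f : S) (γ γ' : ℤ × ℤ) : Prop :=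
  (∀ x ∈ Sgr r γ, x ∉ J1 f → ∃ y ∈ Sgr r γ', x * y ∉ J1 f) ∧
  (∀ y ∈ Sgr r γ', y ∉ J1 f → ∃ x ∈ Sgr r γ, x * y ∉ J1 f)

/-- The Euler operator `xᵢ ∂/∂xᵢ` multiplies the coefficient at `m` by `mᵢ`. -/
lemma coeff_X_mul_pderiv (i : Fin 4) (f : S) (m : Fin 4 →₀ ℕ) :
    coeff m (X i * pderiv i f) = (m i : ℂ) * coeff m f := by
  classical
  induction f using MvPolynomial.induction_on' with
  | monomial n c =>
    rw [X_mul_pderiv_monomial, coeff_smul, coeff_monomial]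
    split_ifs with h
    · simp [h]
    · simp
  | add g h hg hh => rw [map_add, mul_add, coeff_add, hg, hh, coeff_add, mul_add]

lemma X_mul_pderiv_mem_Sgr {r : ℕ} {γ : ℤ × ℤ} {f : S} (hf : f ∈ Sgr r γ) (i : Fin 4) :
    X i * pderiv i f ∈ Sgr r γ := by
  intro m hm
  rw [mem_support_iff, coeff_X_mul_pderiv] at hm
  exact hf m (mem_support_iff.2 (right_ne_zero_of_mul hm))

lemma wdeg_add (r : ℕ) (u v : Fin 4 →₀ ℕ) : wdeg r (u + v) = wdeg r u + wdeg r v := by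
  ext <;> simp [wdeg] <;> ring

lemma eq_zero_of_wdeg_eq_zero {r : ℕ} {u : Fin 4 →₀ ℕ} (h : wdeg r u = 0) : u = 0 := by
  simp only [wdeg, Prod.mk_eq_zero] at h
  obtain ⟨h₁, h₂⟩ := h
  have h₃ : (0 : ℤ) ≤ (r : ℤ) * (u 3 : ℤ) := by positivity
  ext i
  fin_cases i <;> simp <;> omega

/-- Only the constant term of `q` contributes to the degree `γ` part of `q * g`, `g ∈ S_γ`. -/
lemma coeff_mul_of_mem_Sgr {r : ℕ} {γ : ℤ × ℤ} (q : S) {g : S} (hg : g ∈ Sgr r γ)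
    {m : Fin 4 →₀ ℕ} (hm : wdeg r m = γ) : coeff m (q * g) = coeff 0 q * coeff m g := by
  classical
  rw [coeff_mul]
  refine Finset.sum_eq_single (0, m) ?_ (by simp)
  rintro ⟨u, v⟩ huv hne
  rw [Finset.HasAntidiagonal.mem_antidiagonal] at huv
  dsimp only at huv ⊢
  by_contra hc
  have hv := hg v (mem_support_iff.2 (right_ne_zero_of_mul hc))
  rw [← huv, wdeg_add, hv, add_eq_right] at hm
  obtain rfl := eq_zero_of_wdeg_eq_zero hm
  rw [zero_add] at huv
  exact hne (by rw [huv])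

lemma exists_coeff_eq_of_mem_J0 {r : ℕ} {γ : ℤ × ℤ} {f P : S} (hf : f ∈ Sgr r γ)
    (hP : P ∈ J0 f) :
    ∃ c : Fin 4 → ℂ, ∀ m, wdeg r m = γ → coeff m P = (∑ i, c i * m i) * coeff m f := by
  have hset : {g : S | ∃ i : Fin 4, g = X i * pderiv i f} =
      Set.range fun i : Fin 4 => X i * pderiv i f := by
    ext g; simp [eq_comm]
  rw [J0, hset, Ideal.mem_span_range_iff_exists_fun] at hP
  obtain ⟨q, rfl⟩ := hP
  refine ⟨fun i => coeff 0 (q i), fun m hm => ?_⟩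
  rw [coeff_sum, Finset.sum_mul]
  refine Finset.sum_congr rfl fun i _ => ?_
  rw [coeff_mul_of_mem_Sgr _ (X_mul_pderiv_mem_Sgr hf i) hm, coeff_X_mul_pderiv, mul_assoc]

/-- A nondegenerate `f` has a monomial that does not vanish at a given `p ∉ Z(Σ)`. -/
lemma Nondeg.exists_coeff_ne_zero {f : S} (hnd : Nondeg f) {p : Fin 4 → ℂ} (hp : p ∉ Zexc) :
    ∃ m, coeff m f ≠ 0 ∧ ∀ i, p i = 0 → m i = 0 := by
  obtain ⟨i, hi⟩ := hnd p hp
  rw [eval_eq] at hi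
  obtain ⟨m, -, hm⟩ := Finset.exists_ne_zero_of_sum_ne_zero hi
  rw [coeff_X_mul_pderiv] at hm
  refine ⟨m, right_ne_zero_of_mul (left_ne_zero_of_mul hm), fun j hj => ?_⟩
  by_contra hmj
  refine right_ne_zero_of_mul hm (Finset.prod_eq_zero (Finsupp.mem_support_iff.2 hmj) ?_)
  rw [hj, zero_pow hmj]

lemma coeff_mul_prod_X_eq_zero (h : S) {m : Fin 4 →₀ ℕ} {i : Fin 4} (hi : m i = 0) :
    coeff m (h * (X 0 * X 1 * X 2 * X 3)) = 0 := by
  classical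
  have hX : X i ∣ h * (X 0 * X 1 * X 2 * X 3 : S) := by
    refine Dvd.dvd.mul_left ?_ h
    have : (X 0 * X 1 * X 2 * X 3 : S) = ∏ j : Fin 4, X j := by simp [Fin.prod_univ_four]
    rw [this]
    exact Finset.dvd_prod_of_mem _ (Finset.mem_univ i)
  obtain ⟨g, hg⟩ := hX
  rw [hg, coeff_X_mul', if_neg (by simpa using hi)]

/-- A linear form on exponents that vanishes at three vertices of the polygon of an ample
class vanishes on all exponents of that class. -/
lemma sum_eq_zero_of_vanish_on_vertices {r : ℕ} {a b : ℤ} (hb : 0 < b) {c : Fin 4 → ℂ}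
    (h₀₁ : c 2 * (a - r * b) + c 3 * b = 0)
    (h₁₂ : c 0 * (a - r * b) + c 3 * b = 0) (h₂₃ : c 0 * a + c 1 * b = 0) (hab : r * b < a)
    {m : Fin 4 →₀ ℕ} (hm : wdeg r m = (a, b)) : ∑ i, c i * m i = 0 := by
  have hb' : (b : ℂ) ≠ 0 := by exact_mod_cast hb.ne'
  have hab' : (a : ℂ) - r * b ≠ 0 := by
    have : a - r * b ≠ 0 := by omega
    exact_mod_cast this
  have h02 : c 0 = c 2 := mul_right_cancel₀ hab' (by linear_combination h₁₂ - h₀₁)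
  simp only [wdeg, Prod.mk.injEq] at hm
  have e₁ : (m 0 : ℂ) + m 2 + r * m 3 = a := by exact_mod_cast hm.1
  have e₂ : (m 1 : ℂ) + m 3 = b := by exact_mod_cast hm.2
  refine (mul_eq_zero_iff_right hb').1 ?_
  rw [Fin.sum_univ_four]
  linear_combination b * m 2 * (- h02) + m 1 * h₂₃ + m 3 * h₁₂ + c 0 * b * e₁ - c 0 * a * e₂

/-- For `h ∈ J₁(f)`, the degree `β` part of `x₁x₂x₃x₄ h` vanishes. -/
lemma coeff_mul_prod_X_eq_zero_of_mem_J1 {r : ℕ} {a b : ℤ} (hβ : (r : ℤ) * b < a ∧ 0 < b)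
    {f : S} (hf : f ∈ Sgr r (a, b)) (hnd : Nondeg f) {h : S} (hh : h ∈ J1 f)
    {m : Fin 4 →₀ ℕ} (hm : wdeg r m = (a, b)) :
    coeff m (h * (X 0 * X 1 * X 2 * X 3)) = 0 := by
  have hP : h * (X 0 * X 1 * X 2 * X 3) ∈ J0 f :=
    Submodule.mem_colon.1 hh _ (Ideal.mem_span_singleton_self _)
  obtain ⟨c, hc⟩ := exists_coeff_eq_of_mem_J0 hf hP
  have vertex (p : Fin 4 → ℂ) (hp : p ∉ Zexc) (i : Fin 4) (hi : p i = 0) :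
      ∃ n : Fin 4 →₀ ℕ, ∑ j, c j * n j = 0 ∧ (∀ j, p j = 0 → n j = 0) ∧
        (n 0 : ℂ) + n 2 + r * n 3 = a ∧ (n 1 : ℂ) + n 3 = b := by
    obtain ⟨n, hn, hpn⟩ := hnd.exists_coeff_ne_zero hp
    have hw := hf n (mem_support_iff.2 hn)
    have hz := hc n hw
    rw [coeff_mul_prod_X_eq_zero h (hpn i hi), eq_comm, mul_eq_zero_iff_right hn] at hz
    simp only [wdeg, Prod.mk.injEq] at hw
    exact ⟨n, hz, hpn, by exact_mod_cast hw.1, by exact_mod_cast hw.2⟩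
  obtain ⟨n₁, s₁, z₁, u₁, v₁⟩ := vertex ![0, 0, 1, 1] (by simp [Zexc]) 0 (by simp)
  obtain ⟨n₂, s₂, z₂, u₂, v₂⟩ := vertex ![1, 0, 0, 1] (by simp [Zexc]) 1 (by simp)
  obtain ⟨n₃, s₃, z₃, u₃, v₃⟩ := vertex ![1, 1, 0, 0] (by simp [Zexc]) 2 (by simp)
  simp [Fin.forall_fin_succ] at z₁ z₂ z₃
  simp [Fin.sum_univ_four, z₁] at s₁ u₁ v₁
  simp [Fin.sum_univ_four, z₂] at s₂ u₂ v₂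
  simp [Fin.sum_univ_four, z₃] at s₃ u₃ v₃
  rw [hc m hm, sum_eq_zero_of_vanish_on_vertices hβ.2 _ _ _ hβ.1 hm, zero_mul]
  · rw [← u₁, ← v₁]; linear_combination s₁
  · rw [← u₂, ← v₂]; linear_combination s₂
  · rw [← u₃, ← v₃]; linear_combination s₃

lemma eq_zero_of_mem_J1_of_mem_Sgr {r : ℕ} {a b : ℤ} (hβ : (r : ℤ) * b < a ∧ 0 < b)
    {f : S} (hf : f ∈ Sgr r (a, b)) (hnd : Nondeg f) {h : S} (hh : h ∈ J1 f)
    (hK : h ∈ Sgr r (a - r - 2, b - 2)) : h = 0 := by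
  ext m
  rw [coeff_zero]
  by_contra hm
  have hw := hK m (mem_support_iff.2 hm)
  refine hm ?_
  have hX : (X 0 * X 1 * X 2 * X 3 : S) = monomial (Finsupp.equivFunOnFinite.symm 1) 1 := by
    rw [monomial_eq, Finsupp.prod_fintype _ _ (by simp)]
    simp [Fin.prod_univ_four]
  have key := coeff_mul_prod_X_eq_zero_of_mem_J1 hβ hf hnd hh
    (m := m + Finsupp.equivFunOnFinite.symm 1) ?_
  · rwa [hX, coeff_mul_monomial, mul_one] at key
  · simp only [wdeg, Prod.mk.injEq] at hw
    rw [wdeg_add]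
    ext <;> simp [wdeg] <;> linarith

/-- for `β = (a,b)` ample and `f ∈ S_β` nondegenerate,
`J₁(f) ∩ S_{β+K} = {0}`; in particular the quotient map `S_{β+K} → R₁(f)_{β+K}`
is an isomorphism and `dim_ℂ R₁(f)_{β+K} = dim_ℂ S_{β+K} = g`, the genus of the
curve `{f = 0}`. -/
theorem stmt_14 (r : ℕ) (a b : ℤ) (hβ : (r : ℤ) * b < a ∧ 0 < b)
    (f : S) (hf : f ∈ Sgr r (a, b)) (hnd : Nondeg f) :
    Submodule.restrictScalars ℂ (J1 f) ⊓ Sgr r (a - r - 2, b - 2) = ⊥ ∧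
    Module.finrank ℂ ↥(R1 r f (a - r - 2, b - 2))
      = Module.finrank ℂ ↥(Sgr r (a - r - 2, b - 2)) := by
  have hzero : ∀ h ∈ J1 f, h ∈ Sgr r (a - r - 2, b - 2) → h = 0 := fun _ hh hK =>
    eq_zero_of_mem_J1_of_mem_Sgr hβ hf hnd hh hK
  refine ⟨(Submodule.eq_bot_iff _).2 fun h hh => hzero h hh.1 hh.2, ?_⟩
  rw [R1, ← LinearMap.range_domRestrict]
  refine LinearMap.finrank_range_of_inj ?_
  rw [← LinearMap.ker_eq_bot, LinearMap.ker_eq_bot']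
  rintro ⟨h, hK⟩ hh
  exact Subtype.ext (hzero h (Ideal.Quotient.eq_zero_iff_mem.1 hh) hK)
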